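/- Let ν > 0 be a real number that is not an integer. Then for every z > 0 and every j ∈ {0,1}: I_{ν+j}(z) · K_ν(z) ≤ 1/(2ν). -/

import Mathlib

open scoped Real

noncomputable section

/-- The modified Bessel function of the first kind `I_μ(z)`, via its power series;
`1/Γ` is interpreted as `0` at the poles of `Γ` (Mathlib's `Real.Gamma` vanishes there). -/
noncomputable def besselI (μ z : ℝ) : ℝ :=
  (z/2) ^ μ * ∑' k : ℕ, (z/2) ^ (2*k) / ((k.factorial : ℝ) * Real.Gamma (μ + k + 1))

/-- The modified Bessel function of the second kind `K_ν(z)` for non-integer `ν > 0`. -/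
noncomputable def besselK (ν z : ℝ) : ℝ :=
  (π/2) * (besselI (-ν) z - besselI ν z) / Real.sin (ν * π)

open Filter Topology Asymptotics

/-- The coefficient `1 / (k! Γ(a + k + 1))` of the modified Bessel series. -/
def besselCoeff (a : ℝ) (k : ℕ) : ℝ := 1 / ((k.factorial : ℝ) * Real.Gamma (a + k + 1))

/-- The entire function `∑ t ^ k / (k! Γ(a + k + 1))`. -/
def besselSum (a t : ℝ) : ℝ := ∑' k : ℕ, besselCoeff a k * t ^ k

theorem besselI_eq (μ z : ℝ) : besselI μ z = (z / 2) ^ μ * besselSum μ ((z / 2) ^ 2) := by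
  simp only [besselI, besselSum, besselCoeff, pow_mul, one_div_mul_eq_div]

theorem inv_Gamma_eq (s : ℝ) : (Real.Gamma s)⁻¹ = s * (Real.Gamma (s + 1))⁻¹ := by
  rcases eq_or_ne s 0 with rfl | h
  · simp
  · rw [Real.Gamma_add_one h, mul_inv, mul_inv_cancel_left₀ h]

theorem besselCoeff_pos {a : ℝ} (ha : -1 < a) (k : ℕ) : 0 < besselCoeff a k := by
  have hk : (0 : ℝ) ≤ k := k.cast_nonneg
  have : 0 < Real.Gamma (a + k + 1) := Real.Gamma_pos_of_pos (by linarith)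
  unfold besselCoeff
  positivity

theorem besselCoeff_add_one (a : ℝ) (k : ℕ) :
    besselCoeff a k = (a + k + 1) * besselCoeff (a + 1) k := by
  unfold besselCoeff
  rw [one_div, one_div, mul_inv, mul_inv, inv_Gamma_eq (a + k + 1),
    show a + 1 + (k : ℝ) + 1 = a + k + 1 + 1 by ring]
  ring

theorem besselCoeff_succ (a : ℝ) (k : ℕ) :
    (k + 1 : ℝ) * besselCoeff a (k + 1) = besselCoeff (a + 1) k := by
  unfold besselCoeff
  rw [Nat.factorial_succ]
  push_cast
  rw [show a + ((k : ℝ) + 1) + 1 = a + 1 + k + 1 by ring]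
  have : (k : ℝ) + 1 ≠ 0 := by positivity
  have : (k.factorial : ℝ) ≠ 0 := by positivity
  field_simp

theorem exists_abs_besselCoeff_le (a : ℝ) :
    ∃ M : ℝ, ∀ k : ℕ, |besselCoeff a k| ≤ M / k.factorial := by
  obtain ⟨N, hN⟩ := exists_nat_gt (1 - a)
  have hle : ∀ k : ℕ, N ≤ k → |(Real.Gamma (a + k + 1))⁻¹| ≤ 1 := by
    intro k hk
    have hk' : (N : ℝ) ≤ k := by exact_mod_cast hk
    have h2 : (2 : ℝ) ≤ a + k + 1 := by linarith
    have h1 : 1 ≤ Real.Gamma (a + k + 1) := by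
      have := Real.Gamma_strictMonoOn_Ici.monotoneOn (Set.mem_Ici.2 le_rfl) (Set.mem_Ici.2 h2) h2
      rwa [Real.Gamma_two] at this
    rw [abs_of_pos (by positivity)]
    exact inv_le_one_of_one_le₀ h1
  refine ⟨1 + ∑ k ∈ Finset.range N, |(Real.Gamma (a + k + 1))⁻¹|, fun k => ?_⟩
  rw [besselCoeff, one_div, mul_inv, abs_mul, abs_of_pos (by positivity), inv_mul_eq_div]
  gcongr
  rcases le_or_gt N k with h | h
  · exact (hle k h).trans (le_add_of_nonneg_right (Finset.sum_nonneg fun _ _ => abs_nonneg _))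
  · have := Finset.single_le_sum (f := fun k : ℕ => |(Real.Gamma (a + k + 1))⁻¹|)
      (fun _ _ => abs_nonneg _) (Finset.mem_range.2 h)
    linarith

theorem summable_besselSum (a t : ℝ) : Summable fun k : ℕ => besselCoeff a k * t ^ k := by
  obtain ⟨M, hM⟩ := exists_abs_besselCoeff_le a
  refine Summable.of_norm_bounded ((Real.summable_pow_div_factorial |t|).mul_left M) fun k => ?_
  rw [Real.norm_eq_abs, abs_mul, abs_pow]
  calc _ ≤ M / k.factorial * |t| ^ k := by gcongr; exact hM k
    _ = _ := by ring

theorem hasDerivAt_besselSum (a t : ℝ) : HasDerivAt (besselSum a) (besselSum (a + 1) t) t := by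
  obtain ⟨M, hM⟩ := exists_abs_besselCoeff_le a
  have hM0 : 0 ≤ M := by simpa using (abs_nonneg _).trans (hM 0)
  set R := |t| + 1
  have hu : Summable fun k : ℕ => M / k.factorial * (k * R ^ (k - 1)) := by
    rw [← summable_nat_add_iff 1]
    refine ((Real.summable_pow_div_factorial R).mul_left M).congr fun k => ?_
    have : (k.factorial : ℝ) ≠ 0 := by positivity
    rw [Nat.factorial_succ]
    push_cast
    field_simp
  have ht : t ∈ Metric.ball (0 : ℝ) R := by simp [R]
  have key := hasDerivAt_tsum_of_isPreconnected (g := fun k y => besselCoeff a k * y ^ k)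
    (g' := fun k y => besselCoeff a k * (k * y ^ (k - 1))) hu Metric.isOpen_ball
    (convex_ball (0 : ℝ) R).isPreconnected (fun k y _ => (hasDerivAt_pow k y).const_mul _)
    (fun k y hy => by
      have hy' : |y| ≤ R := by simpa using (Metric.mem_ball.1 hy).le
      rw [Real.norm_eq_abs, abs_mul, abs_mul, abs_pow, Nat.abs_cast]
      gcongr
      exact hM k) ht (summable_besselSum a t) ht
  have hsum : ∑' k : ℕ, besselCoeff a k * (k * t ^ (k - 1)) = besselSum (a + 1) t := by
    have hterm : ∀ k : ℕ, besselCoeff a (k + 1) * ((k + 1 : ℕ) * t ^ (k + 1 - 1)) =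
        besselCoeff (a + 1) k * t ^ k := fun k => by
      rw [← besselCoeff_succ a k, Nat.add_sub_cancel]
      push_cast
      ring
    have hs : Summable fun k : ℕ => besselCoeff a k * (k * t ^ (k - 1)) := by
      rw [← summable_nat_add_iff 1]
      exact (summable_besselSum (a + 1) t).congr fun k => (hterm k).symm
    rw [hs.tsum_eq_zero_add]
    simp only [hterm]
    simp [besselSum]
  rw [hsum] at key
  exact key

theorem besselSum_recurrence (a t : ℝ) :
    besselSum a t = (a + 1) * besselSum (a + 1) t + t * besselSum (a + 2) t := by
  have hs := summable_besselSum (a + 1) t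
  have hs2 := summable_besselSum (a + 2) t
  have hterm : ∀ k : ℕ, ((k + 1 : ℕ) : ℝ) * (besselCoeff (a + 1) (k + 1) * t ^ (k + 1)) =
      t * (besselCoeff (a + 2) k * t ^ k) := fun k => by
    rw [show a + 2 = a + 1 + 1 by ring, ← besselCoeff_succ (a + 1) k]
    push_cast
    ring
  have hk : Summable fun k : ℕ => (k : ℝ) * (besselCoeff (a + 1) k * t ^ k) := by
    rw [← summable_nat_add_iff 1]
    exact (hs2.mul_left t).congr fun k => (hterm k).symm
  have hk' : ∑' k : ℕ, (k : ℝ) * (besselCoeff (a + 1) k * t ^ k) = t * besselSum (a + 2) t := by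
    rw [hk.tsum_eq_zero_add]
    simp only [hterm]
    simp [besselSum, tsum_mul_left]
  rw [← hk', besselSum, besselSum, ← tsum_mul_left, ← (hs.mul_left (a + 1)).tsum_add hk]
  refine tsum_congr fun k => ?_
  rw [besselCoeff_add_one]
  ring

theorem besselSum_zero (a : ℝ) : besselSum a 0 = (Real.Gamma (a + 1))⁻¹ := by
  rw [besselSum, tsum_eq_single 0 fun k hk => by simp [hk]]
  simp [besselCoeff]

theorem inv_Gamma_le_besselSum {a t : ℝ} (ha : -1 < a) (ht : 0 ≤ t) :
    (Real.Gamma (a + 1))⁻¹ ≤ besselSum a t := by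
  have := (summable_besselSum a t).le_tsum 0 fun k _ =>
    mul_nonneg (besselCoeff_pos ha k).le (pow_nonneg ht k)
  simpa [besselCoeff, besselSum] using this

theorem besselSum_pos {a t : ℝ} (ha : -1 < a) (ht : 0 ≤ t) : 0 < besselSum a t :=
  (inv_pos.2 (Real.Gamma_pos_of_pos (by linarith))).trans_le (inv_Gamma_le_besselSum ha ht)

/-- The Casoratian of the two solutions of the Bessel recurrence does not depend on `t`. -/
theorem besselSum_casoratian (a t : ℝ) :
    besselSum a t * besselSum (-a - 1) t - t * (besselSum (a + 1) t * besselSum (-a) t) =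
      -(Real.sin (a * π) / π) := by
  have hd : ∀ t, HasDerivAt (fun t => besselSum a t * besselSum (-a - 1) t -
      t * (besselSum (a + 1) t * besselSum (-a) t)) 0 t := by
    intro t
    have h1 := hasDerivAt_besselSum a t
    have h2 := hasDerivAt_besselSum (-a - 1) t
    have h3 := hasDerivAt_besselSum (a + 1) t
    have h4 := hasDerivAt_besselSum (-a) t
    refine ((h1.mul h2).sub ((hasDerivAt_id t).mul (h3.mul h4))).congr_deriv ?_
    have r1 := besselSum_recurrence a t
    have r2 := besselSum_recurrence (-a - 1) t
    rw [show -a - 1 + 1 = -a by ring, show -a - 1 + 2 = -a + 1 by ring] at r2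
    simp only [id, Pi.mul_apply, show -a - 1 + 1 = -a by ring, show a + 1 + 1 = a + 2 by ring]
    rw [r1, r2]
    ring
  have hc := is_const_of_deriv_eq_zero (fun t => (hd t).differentiableAt)
    (fun t => (hd t).deriv) t 0
  rw [hc, zero_mul, sub_zero, besselSum_zero, besselSum_zero, ← mul_inv,
    show -a - 1 + 1 = -a by ring]
  have := Real.Gamma_mul_Gamma_one_sub (-a)
  rw [show 1 - -a = a + 1 by ring, mul_comm] at this
  rw [this, mul_neg, Real.sin_neg, div_neg, inv_neg, inv_div, mul_comm π a]

theorem mul_besselSum_add_one_le {a x : ℝ} (ha : 0 ≤ a) :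
    x * besselSum (a + 1) (x ^ 2) ≤ besselSum a (x ^ 2) := by
  have hs := summable_besselSum a (x ^ 2)
  have hs1 := (summable_nat_add_iff 1).2 hs
  have h0 : 0 ≤ besselCoeff a 0 * (x ^ 2) ^ 0 := by
    simpa using (besselCoeff_pos (by linarith) 0).le
  have hsplit := hs.tsum_eq_zero_add
  have hle : x * besselSum (a + 1) (x ^ 2) ≤ ∑' k : ℕ, (besselCoeff a k * (x ^ 2) ^ k +
      besselCoeff a (k + 1) * (x ^ 2) ^ (k + 1)) / 2 := by
    rw [besselSum, ← tsum_mul_left]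
    refine ((summable_besselSum (a + 1) (x ^ 2)).mul_left x).tsum_le_tsum (fun k => ?_)
      ((hs.add hs1).div_const 2)
    have hm : (0 : ℝ) < k + 1 := by positivity
    have hc := besselCoeff_pos (a := a) (by linarith) (k + 1)
    have hcp : 0 ≤ besselCoeff a (k + 1) * (x ^ 2) ^ k := by positivity
    rw [besselCoeff_add_one a, ← besselCoeff_succ a k, pow_succ (x ^ 2) k]
    have hq : 0 ≤ (a + k + 1) * (k + 1) + x ^ 2 - 2 * x * (k + 1) := by
      nlinarith [sq_nonneg (x - (k + 1)), mul_nonneg ha hm.le]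
    nlinarith [mul_nonneg hcp hq]
  rw [tsum_div_const, hs.tsum_add hs1] at hle
  change besselSum a (x ^ 2) = _ at hsplit
  change _ ≤ (besselSum a (x ^ 2) + _) / 2 at hle
  linarith

theorem besselSum_sub_le {a x : ℝ} (ha : 0 ≤ a) (hx : 0 < x) :
    besselSum a (x ^ 2) - x * besselSum (a + 1) (x ^ 2) ≤ (a + 1) / x * besselSum a (x ^ 2) := by
  have h1 := mul_besselSum_add_one_le (x := x) ha
  have h2 := mul_besselSum_add_one_le (x := x) (a := a + 1) (by linarith)
  rw [show a + 1 + 1 = a + 2 by ring] at h2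
  have h3 := besselSum_recurrence a (x ^ 2)
  have h4 : (a + 1) * besselSum (a + 1) (x ^ 2) ≤ (a + 1) / x * besselSum a (x ^ 2) := by
    rw [div_mul_eq_mul_div, le_div_iff₀ hx]
    nlinarith
  nlinarith

theorem Gamma_add_le {s θ : ℝ} (hs : 0 < s) (h0 : 0 ≤ θ) (h1 : θ ≤ 1) :
    Real.Gamma (s + θ) ≤ Real.Gamma s * s ^ θ := by
  rcases h0.eq_or_lt with rfl | h0
  · simp
  rcases h1.eq_or_lt with rfl | h1
  · rw [Real.Gamma_add_one hs.ne', Real.rpow_one, mul_comm]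
  have hG := Real.Gamma_pos_of_pos hs
  have := Real.Gamma_mul_add_mul_le_rpow_Gamma_mul_rpow_Gamma hs (t := s + 1) (by linarith)
    (sub_pos.2 h1) h0 (by ring)
  rw [show (1 - θ) * s + θ * (s + 1) = s + θ by ring, Real.Gamma_add_one hs.ne',
    Real.mul_rpow hs.le hG.le, mul_left_comm, ← Real.rpow_add hG, sub_add_cancel,
    Real.rpow_one, mul_comm] at this
  exact this

theorem le_rpow_of_mem_Icc {v θ δ : ℝ} (hv : 0 < v) (hδ : 0 < δ) (h0 : 0 ≤ θ) (h1 : θ ≤ 1) :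
    1 - δ / 2 - (1 - v) ^ 2 / (2 * δ) ≤ v ^ θ := by
  have hmin : 1 - |1 - v| ≤ v ^ θ := by
    rcases le_total v 1 with h | h
    · rw [abs_of_nonneg (by linarith)]
      have := Real.rpow_le_rpow_of_exponent_ge hv h h1
      rw [Real.rpow_one] at this
      linarith
    · have := Real.one_le_rpow h h0
      linarith [abs_nonneg (1 - v)]
  refine le_trans ?_ hmin
  have : |1 - v| ≤ δ / 2 + (1 - v) ^ 2 / (2 * δ) := by
    rw [← sq_abs, div_add_div _ _ two_ne_zero (by positivity), le_div_iff₀ (by positivity)]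
    nlinarith [sq_nonneg (|1 - v| - δ)]
  linarith

/-- Interpolation between the orders `a` and `a + 1`, from log-convexity of the Gamma function. -/
theorem le_rpow_mul_besselSum {a b x δ : ℝ} (ha : 0 ≤ a) (hab : a ≤ b) (hba : b ≤ a + 1)
    (hx : 0 < x) (hδ : 0 < δ) :
    (1 - δ / 2 - (a + 1) / (x * δ)) * besselSum a (x ^ 2) ≤
      x ^ (b - a) * besselSum b (x ^ 2) := by
  have hs := summable_besselSum a (x ^ 2)
  have hs1 := (summable_nat_add_iff 1).2 hs
  have hsa := summable_besselSum (a + 1) (x ^ 2)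
  have hsb := summable_besselSum b (x ^ 2)
  have hterm : ∀ k : ℕ, (1 - δ / 2) * (besselCoeff a k * (x ^ 2) ^ k) -
      (besselCoeff a k * (x ^ 2) ^ k - 2 * x * (besselCoeff (a + 1) k * (x ^ 2) ^ k) +
        besselCoeff a (k + 1) * (x ^ 2) ^ (k + 1)) / (2 * δ) ≤
      x ^ (b - a) * (besselCoeff b k * (x ^ 2) ^ k) := by
    intro k
    have hm : (0 : ℝ) < k + 1 := by positivity
    have hs0 : 0 < a + k + 1 := by linarith
    set v := x / (a + k + 1) with hv
    have hv0 : 0 < v := by positivity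
    have hxv : x = v * (a + k + 1) := by rw [hv, div_mul_cancel₀ _ hs0.ne']
    have hc := besselCoeff_pos (a := a) (by linarith) k
    have hpow : v ^ (b - a) * besselCoeff a k ≤ x ^ (b - a) * besselCoeff b k := by
      have hΓ := Gamma_add_le hs0 (sub_nonneg.2 hab) (by linarith : b - a ≤ 1)
      have hΓ0 : 0 < Real.Gamma (b + k + 1) := Real.Gamma_pos_of_pos (by linarith)
      have hΓ1 : 0 < Real.Gamma (a + k + 1) := Real.Gamma_pos_of_pos hs0
      rw [show a + k + 1 + (b - a) = b + k + 1 by ring] at hΓ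
      have hr : 0 < (a + k + 1) ^ (b - a) := Real.rpow_pos_of_pos hs0 _
      rw [hv, Real.div_rpow hx.le hs0.le, besselCoeff, besselCoeff, div_mul_div_comm, mul_one,
        mul_one_div]
      refine div_le_div_of_nonneg_left (by positivity) (by positivity) ?_
      calc _ ≤ (k.factorial : ℝ) * (Real.Gamma (a + k + 1) * (a + k + 1) ^ (b - a)) := by gcongr
        _ = _ := by ring
    have hle := le_rpow_of_mem_Icc hv0 hδ (sub_nonneg.2 hab) (by linarith : b - a ≤ 1)
    have hsq : besselCoeff a k * v ^ 2 ≤ besselCoeff a (k + 1) * x ^ 2 := by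
      have h2 := besselCoeff_succ a k
      have h3 := besselCoeff_pos (a := a) (by linarith) (k + 1)
      rw [besselCoeff_add_one a, ← h2, hxv]
      have : 0 ≤ besselCoeff a (k + 1) * v ^ 2 * (a + k + 1) := by positivity
      nlinarith [mul_nonneg this ha]
    have hlin : x * besselCoeff (a + 1) k = besselCoeff a k * v := by
      rw [besselCoeff_add_one a k]
      nth_rw 1 [hxv]
      ring
    have hmain : (1 - δ / 2) * besselCoeff a k - (besselCoeff a k -
        2 * (x * besselCoeff (a + 1) k) + besselCoeff a (k + 1) * x ^ 2) / (2 * δ) ≤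
        x ^ (b - a) * besselCoeff b k := by
      refine le_trans ?_ ((mul_le_mul_of_nonneg_right hle hc.le).trans hpow)
      rw [hlin]
      have : (besselCoeff a k * (1 - v) ^ 2) / (2 * δ) ≤ (besselCoeff a k -
        2 * (besselCoeff a k * v) + besselCoeff a (k + 1) * x ^ 2) / (2 * δ) := by
        gcongr
        linarith
      calc _ ≤ (1 - δ / 2) * besselCoeff a k - (besselCoeff a k * (1 - v) ^ 2) / (2 * δ) := by
            linarith
        _ = _ := by ring
    calc _ = ((1 - δ / 2) * besselCoeff a k - (besselCoeff a k -
        2 * (x * besselCoeff (a + 1) k) + besselCoeff a (k + 1) * x ^ 2) / (2 * δ)) *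
          (x ^ 2) ^ k := by ring
      _ ≤ x ^ (b - a) * besselCoeff b k * (x ^ 2) ^ k := by gcongr
      _ = _ := by ring
  have hsum := Summable.tsum_le_tsum hterm ((hs.mul_left _).sub
    (((hs.sub (hsa.mul_left (2 * x))).add hs1).div_const _)) (hsb.mul_left _)
  rw [(hs.mul_left _).tsum_sub (((hs.sub (hsa.mul_left (2 * x))).add hs1).div_const _),
    tsum_div_const, (hs.sub (hsa.mul_left (2 * x))).tsum_add hs1, hs.tsum_sub (hsa.mul_left _),
    tsum_mul_left, tsum_mul_left, tsum_mul_left] at hsum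
  have hsplit := hs.tsum_eq_zero_add
  have h0 : 0 ≤ besselCoeff a 0 * (x ^ 2) ^ 0 := by
    simpa using (besselCoeff_pos (by linarith) 0).le
  change (1 - δ / 2) * besselSum a (x ^ 2) - (besselSum a (x ^ 2) -
    2 * x * besselSum (a + 1) (x ^ 2) + _) / (2 * δ) ≤ x ^ (b - a) * besselSum b (x ^ 2) at hsum
  change besselSum a (x ^ 2) = _ at hsplit
  refine le_trans ?_ hsum
  have hle : (besselSum a (x ^ 2) - 2 * x * besselSum (a + 1) (x ^ 2) +
      ∑' k : ℕ, besselCoeff a (k + 1) * (x ^ 2) ^ (k + 1)) / (2 * δ) ≤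
      (2 * ((a + 1) / x * besselSum a (x ^ 2))) / (2 * δ) := by
    gcongr
    linarith [besselSum_sub_le ha hx]
  have heq : (2 * ((a + 1) / x * besselSum a (x ^ 2))) / (2 * δ) =
      (a + 1) / (x * δ) * besselSum a (x ^ 2) := by field_simp
  linarith

theorem besselI_pos {μ z : ℝ} (hμ : -1 < μ) (hz : 0 < z) : 0 < besselI μ z := by
  rw [besselI_eq]
  exact mul_pos (by positivity) (besselSum_pos hμ (by positivity))

theorem besselI_recurrence (μ : ℝ) {z : ℝ} (hz : 0 < z) :
    besselI μ z = besselI (μ + 2) z + 2 * (μ + 1) / z * besselI (μ + 1) z := by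
  have hx : 0 < z / 2 := by positivity
  rw [besselI_eq, besselI_eq, besselI_eq, besselSum_recurrence μ, Real.rpow_add hx,
    Real.rpow_add hx, Real.rpow_one, Real.rpow_two]
  field_simp
  ring

theorem besselI_add_one_le {μ z : ℝ} (hμ : 0 ≤ μ) (hz : 0 < z) :
    besselI (μ + 1) z ≤ besselI μ z := by
  rw [besselI_eq, besselI_eq, Real.rpow_add (by positivity), Real.rpow_one, mul_assoc]
  gcongr
  exact mul_besselSum_add_one_le hμ

theorem besselI_sub_le {μ z : ℝ} (hμ : 0 ≤ μ) (hz : 0 < z) :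
    besselI μ z - besselI (μ + 1) z ≤ 2 * (μ + 1) / z * besselI μ z := by
  have h1 := besselI_add_one_le (μ := μ + 1) (by linarith) hz
  rw [show μ + 1 + 1 = μ + 2 by ring] at h1
  have h2 : 2 * (μ + 1) / z * besselI (μ + 1) z ≤ 2 * (μ + 1) / z * besselI μ z := by
    gcongr
    exact besselI_add_one_le hμ hz
  linarith [besselI_recurrence μ hz]

theorem le_besselI_of_le {μ κ z δ : ℝ} (hμ : 0 ≤ μ) (h : μ ≤ κ) (h' : κ ≤ μ + 1)
    (hz : 0 < z) (hδ : 0 < δ) :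
    (1 - δ / 2 - 2 * (μ + 1) / (z * δ)) * besselI μ z ≤ besselI κ z := by
  have hx : 0 < z / 2 := by positivity
  have key := mul_le_mul_of_nonneg_left (le_rpow_mul_besselSum hμ h h' hx hδ)
    (Real.rpow_nonneg hx.le μ)
  rw [← mul_assoc (_ ^ μ) (_ ^ (κ - μ)), ← Real.rpow_add hx, add_sub_cancel, ← besselI_eq] at key
  refine le_trans (le_of_eq ?_) key
  rw [besselI_eq]
  field_simp

theorem besselI_add_one_isEquivalent (μ : ℝ) : besselI (μ + 1) ~[atTop] besselI μ := by
  have hlit : ∀ c κ : ℝ, (fun z => 2 * c / z * besselI κ z) =o[atTop] besselI κ := fun c κ => by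
    have : (fun z : ℝ => 2 * c / z) =o[atTop] fun _ => (1 : ℝ) :=
      (isLittleO_one_iff ℝ).2 (tendsto_const_nhds.div_atTop tendsto_id)
    simpa using this.mul_isBigO (isBigO_refl (besselI κ) atTop)
  have hnonneg : ∀ κ : ℝ, 0 ≤ κ → besselI (κ + 1) ~[atTop] besselI κ := fun κ hκ => by
    refine IsBigO.trans_isLittleO (IsBigO.of_bound 1 ?_) (hlit (κ + 1) κ)
    filter_upwards [eventually_gt_atTop 0] with z hz
    have h1 := besselI_sub_le hκ hz
    have h2 := besselI_add_one_le hκ hz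
    rw [Pi.sub_apply, Real.norm_eq_abs, abs_sub_comm, abs_of_nonneg (by linarith), one_mul]
    exact h1.trans (le_abs_self _)
  have hdesc : ∀ n : ℕ, ∀ κ : ℝ, 0 ≤ κ + n → besselI (κ + 1) ~[atTop] besselI κ := by
    intro n
    induction n with
    | zero => exact fun κ h => hnonneg κ (by simpa using h)
    | succ n ih =>
      intro κ h
      have h1 := ih (κ + 1) (by push_cast at h; linarith)
      rw [show κ + 1 + 1 = κ + 2 by ring] at h1
      refine ((h1.add_isLittleO (hlit (κ + 1) (κ + 1))).congr_left ?_).symm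
      filter_upwards [eventually_gt_atTop 0] with z hz
      exact (besselI_recurrence κ hz).symm
  obtain ⟨n, hn⟩ := exists_nat_ge (-μ)
  exact hdesc n μ (by linarith)

theorem besselI_add_nat_isEquivalent (μ : ℝ) (n : ℕ) :
    besselI (μ + n) ~[atTop] besselI μ := by
  induction n with
  | zero => simpa using IsEquivalent.refl
  | succ n ih =>
    rw [Nat.cast_succ, ← add_assoc]
    exact (besselI_add_one_isEquivalent (μ + n)).trans ih

theorem besselI_isEquivalent_of_le {μ κ : ℝ} (hμ : 1 ≤ μ) (h : μ ≤ κ) (h' : κ ≤ μ + 1) :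
    besselI κ ~[atTop] besselI μ := by
  have hδ : ∀ c : ℝ, Tendsto (fun z : ℝ => 1 - (√z)⁻¹ / 2 - 2 * c / (z * (√z)⁻¹)) atTop (𝓝 1) := by
    intro c
    have hs : Tendsto (fun z : ℝ => (√z)⁻¹) atTop (𝓝 0) :=
      tendsto_inv_atTop_zero.comp Real.tendsto_sqrt_atTop
    have : Tendsto (fun z : ℝ => 1 - (√z)⁻¹ / 2 - 2 * c * (√z)⁻¹) atTop (𝓝 1) := by
      simpa using (hs.div_const 2).const_sub 1 |>.sub (hs.const_mul (2 * c))
    refine this.congr' ?_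
    filter_upwards [eventually_gt_atTop 0] with z hz
    have : z * (√z)⁻¹ = √z := by
      rw [← div_eq_mul_inv, Real.div_sqrt]
    rw [this, ← div_eq_mul_inv]
  have hne : ∀ᶠ z in atTop, besselI μ z ≠ 0 := by
    filter_upwards [eventually_gt_atTop 0] with z hz
    exact (besselI_pos (by linarith) hz).ne'
  rw [isEquivalent_iff_tendsto_one hne]
  have hup := (hδ (κ - 1 + 1)).inv₀ one_ne_zero
  rw [inv_one] at hup
  refine tendsto_of_tendsto_of_tendsto_of_le_of_le' (hδ (μ + 1)) hup ?_ ?_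
  · filter_upwards [eventually_gt_atTop 0] with z hz
    rw [Pi.div_apply, le_div_iff₀ (besselI_pos (by linarith) hz)]
    exact le_besselI_of_le (by linarith) h h' hz (by positivity)
  · filter_upwards [eventually_gt_atTop 0, (hδ (κ - 1 + 1)).eventually (lt_mem_nhds one_pos)]
      with z hz hpos
    have h1 := besselI_add_one_le (μ := κ - 1) (by linarith) hz
    have h2 := le_besselI_of_le (μ := κ - 1) (κ := μ) (by linarith) (by linarith) (by linarith) hz
      (inv_pos.2 (Real.sqrt_pos.2 hz))
    rw [sub_add_cancel] at h1
    rw [Pi.div_apply, div_le_iff₀ (besselI_pos (by linarith) hz), inv_mul_eq_div,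
      le_div_iff₀ hpos, mul_comm]
    exact (mul_le_mul_of_nonneg_left h1 hpos.le).trans h2

theorem besselI_neg_isEquivalent {ν : ℝ} (hν : 0 < ν) : besselI (-ν) ~[atTop] besselI ν := by
  set n := ⌈2 * ν + 1⌉₊
  have h1 : 2 * ν + 1 ≤ n := Nat.le_ceil _
  have h2 : (n : ℝ) < 2 * ν + 1 + 1 := Nat.ceil_lt_add_one (by linarith)
  exact ((besselI_add_nat_isEquivalent (-ν) n).symm.trans (besselI_isEquivalent_of_le
    (μ := ν + 1) (by linarith) (by linarith) (by linarith))).trans (besselI_add_one_isEquivalent ν)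

theorem tendsto_besselI_atTop {ν : ℝ} (hν : 0 < ν) : Tendsto (besselI ν) atTop atTop := by
  have hG : 0 < (Real.Gamma (ν + 1))⁻¹ := inv_pos.2 (Real.Gamma_pos_of_pos (by linarith))
  refine tendsto_atTop_mono' atTop ?_ (((tendsto_rpow_atTop hν).comp
    (tendsto_id.atTop_div_const two_pos)).atTop_mul_const hG)
  filter_upwards [eventually_gt_atTop 0] with z hz
  rw [besselI_eq]
  exact mul_le_mul_of_nonneg_left (inv_Gamma_le_besselSum (by linarith) (by positivity))
    (Real.rpow_nonneg (half_pos hz).le _)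

theorem tendsto_besselK_div_besselI {ν : ℝ} (hν : 0 < ν) :
    Tendsto (fun z => besselK ν z / besselI ν z) atTop (𝓝 0) := by
  have hne : ∀ᶠ z in atTop, besselI ν z ≠ 0 := by
    filter_upwards [eventually_gt_atTop 0] with z hz
    exact (besselI_pos (by linarith) hz).ne'
  have h := ((isEquivalent_iff_tendsto_one hne).1 (besselI_neg_isEquivalent hν)).sub_const 1
    |>.const_mul (π / 2 / Real.sin (ν * π))
  rw [sub_self, mul_zero] at h
  refine h.congr' ?_
  filter_upwards [hne] with z hz
  rw [Pi.div_apply, besselK]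
  field_simp

/-- As a function of `t = (z / 2) ^ 2`, the quantity `1 / (2 ν I_ν(z) ^ 2) - K_ν(z) / I_ν(z)`
is decreasing. -/
theorem antitoneOn_besselSum_ratio {ν : ℝ} (hν : 0 < ν) (hsin : Real.sin (ν * π) ≠ 0) :
    AntitoneOn (fun t => t ^ (-ν) / (2 * ν * besselSum ν t ^ 2) -
      π / 2 / Real.sin (ν * π) * (t ^ (-ν) * besselSum (-ν) t / besselSum ν t - 1))
      (Set.Ioi 0) := by
  have hd : ∀ t ∈ Set.Ioi (0 : ℝ), HasDerivAt (fun t => t ^ (-ν) / (2 * ν * besselSum ν t ^ 2) -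
      π / 2 / Real.sin (ν * π) * (t ^ (-ν) * besselSum (-ν) t / besselSum ν t - 1))
      (-(t ^ (-ν) * besselSum (ν + 1) t / (ν * besselSum ν t ^ 3))) t := by
    intro t (ht : 0 < t)
    have hF := (besselSum_pos (a := ν) (by linarith) ht.le).ne'
    have h1 := hasDerivAt_besselSum ν t
    have h2 := hasDerivAt_besselSum (-ν) t
    have h3 := Real.hasDerivAt_rpow_const (x := t) (p := -ν) (Or.inl ht.ne')
    have hc := besselSum_casoratian ν t
    have hr := besselSum_recurrence (-ν - 1) t
    rw [show -ν - 1 + 1 = -ν by ring, show -ν - 1 + 2 = -ν + 1 by ring] at hr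
    rw [hr] at hc
    refine ((h3.div ((h1.pow 2).const_mul (2 * ν))
      (mul_ne_zero (by positivity) (pow_ne_zero 2 hF))).sub
      ((((h3.mul h2).div h1 hF).sub_const 1).const_mul
        (π / 2 / Real.sin (ν * π)))).congr_deriv ?_
    rw [Real.rpow_sub_one ht.ne']
    simp only [Pi.mul_apply, Pi.pow_apply]
    generalize t ^ (-ν) = p at *
    generalize besselSum ν t = f at *
    generalize besselSum (ν + 1) t = f' at *
    generalize besselSum (-ν) t = g at *
    generalize besselSum (-ν + 1) t = g' at *
    have hS : Real.sin (ν * π) = -π * (f * (-ν * g + t * g') - t * (f' * g)) := by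
      have := Real.pi_pos.ne'
      rw [hc]
      field_simp
    generalize Real.sin (ν * π) = S at *
    field_simp
    rw [hS]
    ring
  refine antitoneOn_of_deriv_nonpos (convex_Ioi 0)
    (fun t ht => (hd t ht).continuousAt.continuousWithinAt)
    (fun t ht => (hd t (interior_subset ht)).differentiableAt.differentiableWithinAt)
    fun t ht => ?_
  have ht' : 0 < t := interior_subset ht
  rw [(hd t ht').deriv]
  have h1 := besselSum_pos (a := ν) (by linarith) ht'.le
  have h2 := besselSum_pos (a := ν + 1) (by linarith) ht'.le
  have : 0 < t ^ (-ν) := Real.rpow_pos_of_pos ht' _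
  exact neg_nonpos.2 (by positivity)

theorem besselI_mul_besselK_le {ν z : ℝ} (hν : 0 < ν) (hsin : Real.sin (ν * π) ≠ 0)
    (hz : 0 < z) : besselI ν z * besselK ν z ≤ 1 / (2 * ν) := by
  have hx : ∀ z : ℝ, 0 < z → ((z / 2) ^ 2) ^ (-ν) / (2 * ν * besselSum ν ((z / 2) ^ 2) ^ 2) -
      π / 2 / Real.sin (ν * π) * (((z / 2) ^ 2) ^ (-ν) * besselSum (-ν) ((z / 2) ^ 2) /
        besselSum ν ((z / 2) ^ 2) - 1) =
      1 / (2 * ν) * (besselI ν z ^ 2)⁻¹ - besselK ν z / besselI ν z := by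
    intro z hz
    have hx : 0 < z / 2 := by positivity
    have hF := (besselSum_pos (a := ν) (by linarith) (sq_nonneg (z / 2))).ne'
    have hp := (Real.rpow_pos_of_pos hx ν).ne'
    have hpow : ((z / 2) ^ 2) ^ (-ν) = (((z / 2) ^ ν) ^ 2)⁻¹ := by
      rw [Real.rpow_neg (by positivity), ← Real.rpow_natCast_mul hx.le, mul_comm,
        Real.rpow_mul_natCast hx.le]
    rw [besselK, besselI_eq, besselI_eq, hpow, Real.rpow_neg hx.le]
    generalize besselSum ν ((z / 2) ^ 2) = f at *
    generalize (z / 2) ^ ν = p at *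
    field_simp
  have hlim : Tendsto (fun z => 1 / (2 * ν) * (besselI ν z ^ 2)⁻¹ - besselK ν z / besselI ν z)
      atTop (𝓝 0) := by
    simpa using (((tendsto_pow_atTop two_ne_zero).comp
      (tendsto_besselI_atTop hν)).inv_tendsto_atTop.const_mul (1 / (2 * ν))).sub
      (tendsto_besselK_div_besselI hν)
  have hI := besselI_pos (μ := ν) (by linarith) hz
  have hnonneg : 0 ≤ 1 / (2 * ν) * (besselI ν z ^ 2)⁻¹ - besselK ν z / besselI ν z := by
    refine le_of_tendsto hlim ?_
    filter_upwards [eventually_ge_atTop z] with w hw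
    have hw0 := hz.trans_le hw
    rw [← hx z hz, ← hx w hw0]
    exact antitoneOn_besselSum_ratio hν hsin (Set.mem_Ioi.2 (by positivity))
      (Set.mem_Ioi.2 (by positivity)) (by gcongr)
  have := mul_nonneg hnonneg (sq_nonneg (besselI ν z))
  have heq : (1 / (2 * ν) * (besselI ν z ^ 2)⁻¹ - besselK ν z / besselI ν z) * besselI ν z ^ 2 =
      1 / (2 * ν) - besselI ν z * besselK ν z := by
    field_simp
  linarith

theorem stmt15 (ν : ℝ) (hν : 0 < ν) (hνZ : ∀ n : ℤ, ν ≠ (n : ℝ)) :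
    ∀ z : ℝ, 0 < z → ∀ j : ℕ, j ≤ 1 →
      besselI (ν + j) z * besselK ν z ≤ 1/(2*ν) := by
  intro z hz j hj
  have hsin : Real.sin (ν * π) ≠ 0 := by
    rw [Real.sin_ne_zero_iff]
    intro n hn
    exact hνZ n (mul_right_cancel₀ Real.pi_pos.ne' hn).symm
  have hmain := besselI_mul_besselK_le hν hsin hz
  interval_cases j
  · simpa using hmain
  · rw [Nat.cast_one]
    rcases le_total 0 (besselK ν z) with hK | hK
    · exact (mul_le_mul_of_nonneg_right (besselI_add_one_le hν.le hz) hK).trans hmain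
    · exact (mul_nonpos_of_nonneg_of_nonpos (besselI_pos (by linarith) hz).le hK).trans
        (by positivity)
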